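/- Let C = C(b₀) for some b₀ ∈ P(m,n), and let b_M and b_m be respectively the maximal and minimal elements of the finite nonempty set 𝔟(C) with respect to the lexicographic order. Then b_M is the unique element of 𝔟(C) of maximal weight and b_m is the unique element of 𝔟(C) of minimal weight: for every b ∈ 𝔟(C) with b ≠ b_M one has |b| < |b_M|, and for every b ∈ 𝔟(C) with b ≠ b_m one has |b| > |b_m|. -/

import Mathlib

/-- `Pmn m n = {0, 1, …, n}^m`: integer sequences `b = (b₁, …, b_m)` with `0 ≤ bᵢ ≤ n`,
encoded as lists of length `m`. -/
def Pmn (m n : ℕ) : Set (List ℕ) := {b | b.length = m ∧ ∀ x ∈ b, x ≤ n}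

/-- `Pmove n b b'` holds iff `b' = Pᵢ(b)` for some `1 ≤ i ≤ m − 1`: the move `Pᵢ` is
defined on sequences with `bᵢ < b_{i+1} < n` by
`Pᵢ(b) = (b₁, …, b_{i-1}, b_{i+1}+1, bᵢ+1, b_{i+2}, …, b_m)`. -/
def Pmove (n : ℕ) (b b' : List ℕ) : Prop :=
  ∃ (u v : List ℕ) (x y : ℕ), x < y ∧ y < n ∧
    b = u ++ x :: y :: v ∧ b' = u ++ (y + 1) :: (x + 1) :: v

/-- Boundary points of `B(m,n)` (0-indexed): `ceil j` is the ceiling point `x_{j+1}`,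
`floor j` is the floor point `x'_{j+1}`, `left i` is the left-side point `y_{i+1}`, and
`right i` is the right-side point `y'_{i+1}`. -/
inductive Bpt : Type where
  | ceil : ℕ → Bpt
  | floor : ℕ → Bpt
  | left : ℕ → Bpt
  | right : ℕ → Bpt
deriving DecidableEq

/-- The new arc created by the first entry `b₁` of a sequence: `{y₁, x₁}` if `b₁ = 0`,
`{x_n, y'₁}` if `b₁ = n`, and `{x_{b₁}, x_{b₁+1}}` if `1 ≤ b₁ ≤ n − 1`. -/
def newPair (n b₁ : ℕ) : Sym2 Bpt :=
  if b₁ = 0 then s(Bpt.left 0, Bpt.ceil 0)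
  else if b₁ = n then s(Bpt.ceil (n - 1), Bpt.right 0)
  else s(Bpt.ceil (b₁ - 1), Bpt.ceil b₁)

/-- The relabeling map from the boundary points of `B(m-1,n)` into those of `B(m,n)`
determined by the first entry `b₁`: side points `ȳᵢ, ȳ'ᵢ` become `y_{i+1}, y'_{i+1}`;
floor points are unchanged; and the ceiling points `(x̄₁, …, x̄_n)` become
`(x₂, …, x_n, y'₁)` if `b₁ = 0`, `(y₁, x₁, …, x_{n-1})` if `b₁ = n`, and
`(y₁, x₁, …, x_{b₁-1}, x_{b₁+2}, …, x_n, y'₁)` if `1 ≤ b₁ ≤ n − 1`. -/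
def relabel (n b₁ : ℕ) : Bpt → Bpt
  | .floor j => .floor j
  | .left i => .left (i + 1)
  | .right i => .right (i + 1)
  | .ceil j =>
      if b₁ = 0 then (if j = n - 1 then .right 0 else .ceil (j + 1))
      else if j = 0 then .left 0
      else if j ≤ b₁ - 1 then .ceil (j - 1)
      else if j = n - 1 then .right 0
      else .ceil (j + 1)

/-- The Catalan state (perfect matching of the boundary points of `B(m,n)`)
realized by a sequence `b ∈ P(m,n)`, defined recursively: the empty sequence pairs
`x_j` with `x'_j` for all `j < n`; for `b = b₁ :: rest`, the matching of `rest` on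
`B(m-1,n)` is transported along `relabel n b₁` and the new arc `newPair n b₁` is added. -/
def catState (n : ℕ) : List ℕ → Set (Sym2 Bpt)
  | [] => {p | ∃ j < n, p = s(Bpt.ceil j, Bpt.floor j)}
  | b₁ :: rest => insert (newPair n b₁) (Sym2.map (relabel n b₁) '' catState n rest)

/-- The fiber `𝔟(C) = {b ∈ P(m,n) : C(b) = C}` of a Catalan state `C`. -/
def bSet (m n : ℕ) (C : Set (Sym2 Bpt)) : Set (List ℕ) :=
  {b ∈ Pmn m n | catState n b = C}

/-- The `t`-th of the points `y₁, x₁, …, x_n, y'₁` of the boundary, `0 ≤ t ≤ n + 1`. -/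
def topPt (n t : ℕ) : Bpt :=
  if t = 0 then .left 0 else if t = n + 1 then .right 0 else .ceil (t - 1)

theorem newPair_eq_topPt {n i : ℕ} (hn : 1 ≤ n) (hi : i ≤ n) :
    newPair n i = s(topPt n i, topPt n (i + 1)) := by
  unfold newPair topPt
  grind

theorem topPt_inj {n s t : ℕ} (hs : s ≤ n + 1) (ht : t ≤ n + 1)
    (h : topPt n s = topPt n t) : s = t := by
  unfold topPt at h
  split_ifs at h <;> simp at h <;> omega

theorem relabel_injective (n i : ℕ) : Function.Injective (relabel n i) := by
  rintro (a | a | a | a) (b | b | b | b) h <;> simp only [relabel] at h <;>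
    (try split_ifs at h) <;> simp at h ⊢ <;> omega

theorem relabel_ne_topPt {n i : ℕ} (hn : 1 ≤ n) (hi : i ≤ n) (p : Bpt) :
    relabel n i p ≠ topPt n i ∧ relabel n i p ≠ topPt n (i + 1) := by
  unfold topPt
  rcases p with a | a | a | a <;> simp only [relabel] <;> constructor <;>
    split_ifs <;> simp <;> omega

theorem map_relabel_injective (n i : ℕ) :
    Function.Injective (Sym2.map (relabel n i)) :=
  Sym2.map.injective (relabel_injective n i)

theorem topPt_notMem_map_relabel {n i : ℕ} (hn : 1 ≤ n) (hi : i ≤ n) (p : Sym2 Bpt) :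
    topPt n i ∉ Sym2.map (relabel n i) p ∧ topPt n (i + 1) ∉ Sym2.map (relabel n i) p := by
  simp only [Sym2.mem_map, not_exists, not_and]
  exact ⟨fun q _ => (relabel_ne_topPt hn hi q).1, fun q _ => (relabel_ne_topPt hn hi q).2⟩

theorem newPair_notMem_image {n i : ℕ} (hn : 1 ≤ n) (hi : i ≤ n) (S : Set (Sym2 Bpt)) :
    newPair n i ∉ Sym2.map (relabel n i) '' S := by
  rintro ⟨p, -, hp⟩
  apply (topPt_notMem_map_relabel hn hi p).1
  rw [hp, newPair_eq_topPt hn hi]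
  exact Sym2.mem_mk_left _ _

theorem insert_image_inj {α β : Type*} {f : α → β} (hf : Function.Injective f) {a : β}
    {S T : Set α} (hS : a ∉ f '' S) (hT : a ∉ f '' T) (h : insert a (f '' S) = insert a (f '' T)) :
    S = T := by
  apply hf.image_injective
  rw [← Set.insert_sdiff_self_of_notMem hS, ← Set.insert_sdiff_self_of_notMem hT, h]

theorem catState_tail_eq {n i : ℕ} (hn : 1 ≤ n) (hi : i ≤ n) {b c : List ℕ}
    (h : catState n (i :: b) = catState n (i :: c)) : catState n b = catState n c :=
  insert_image_inj (map_relabel_injective n i) (newPair_notMem_image hn hi _)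
    (newPair_notMem_image hn hi _) h

theorem catState_cons_congr {n : ℕ} (i : ℕ) {b c : List ℕ} (h : catState n b = catState n c) :
    catState n (i :: b) = catState n (i :: c) := by
  simp only [catState, h]

theorem relabel_ceil (n i j : ℕ) : relabel n i (.ceil j) =
    if j < i then (if j = 0 then .left 0 else .ceil (j - 1))
    else if j = n - 1 then .right 0 else .ceil (j + 1) := by
  unfold relabel
  grind

theorem relabel_floor (n i j : ℕ) : relabel n i (.floor j) = .floor j := rfl

theorem relabel_left (n i j : ℕ) : relabel n i (.left j) = .left (j + 1) := rfl

theorem relabel_right (n i j : ℕ) : relabel n i (.right j) = .right (j + 1) := rfl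

theorem relabel_comp_of_lt {n x y : ℕ} (hxy : x < y) (hy : y < n) :
    relabel n x ∘ relabel n y = relabel n (y + 1) ∘ relabel n (x + 1) := by
  funext p
  rcases p with a | a | a | a <;> simp only [Function.comp_apply]
  all_goals grind [relabel_ceil, relabel_floor, relabel_left, relabel_right]

theorem map_relabel_newPair_of_lt {n x y : ℕ} (hxy : x < y) (hy : y < n) :
    Sym2.map (relabel n x) (newPair n y) = newPair n (y + 1) := by
  unfold newPair
  split_ifs <;> simp only [Sym2.map_mk, relabel] <;> grind

theorem map_relabel_newPair_of_gt {n x y : ℕ} (hxy : x < y) (hy : y < n) :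
    Sym2.map (relabel n (y + 1)) (newPair n (x + 1)) = newPair n x := by
  unfold newPair
  split_ifs <;> simp only [Sym2.map_mk, relabel] <;> grind

/-- A move `Pᵢ` at the first two entries does not change the realized state. -/
theorem catState_move {n x y : ℕ} (hxy : x < y) (hy : y < n) (e : List ℕ) :
    catState n (x :: y :: e) = catState n ((y + 1) :: (x + 1) :: e) := by
  simp only [catState, Set.image_insert_eq, ← Set.image_comp, ← Sym2.map_comp,
    relabel_comp_of_lt hxy hy, map_relabel_newPair_of_lt hxy hy, map_relabel_newPair_of_gt hxy hy]
  exact Set.insert_comm _ _ _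

theorem newPair_inj {n i j : ℕ} (hn : 1 ≤ n) (hi : i ≤ n) (hj : j ≤ n)
    (h : newPair n i = newPair n j) : i = j := by
  rw [newPair_eq_topPt hn hi, newPair_eq_topPt hn hj, Sym2.eq_iff] at h
  rcases h with ⟨h, -⟩ | ⟨h, h'⟩
  · exact topPt_inj (by omega) (by omega) h
  · have := topPt_inj (by omega) (by omega) h
    have := topPt_inj (by omega) (by omega) h'
    omega

theorem newPair_notMem_catState_nil (n j : ℕ) : newPair n j ∉ catState n [] := by
  rintro ⟨k, -, h⟩
  unfold newPair at h
  split_ifs at h <;> simp at h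

theorem newPair_mem_catState_cons (n i : ℕ) (b : List ℕ) : newPair n i ∈ catState n (i :: b) :=
  Set.mem_insert _ _

theorem newPair_pred_mem_tail {n i j : ℕ} (hj : j ≤ n) (hij : i < j) {b : List ℕ}
    (h : newPair n j ∈ catState n (i :: b)) :
    i + 2 ≤ j ∧ newPair n (j - 1) ∈ catState n b := by
  have hn : 1 ≤ n := by omega
  have hi : i ≤ n := by omega
  rcases h with h | ⟨p, hp, h⟩
  · exact absurd (newPair_inj hn hj hi h) (by omega)
  · rcases Nat.lt_or_ge (i + 1) j with hlt | hge
    · refine ⟨hlt, ?_⟩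
      have := map_relabel_newPair_of_lt (n := n) (x := i) (y := j - 1) (by omega) (by omega)
      rw [Nat.sub_add_cancel (by omega), ← h] at this
      rwa [map_relabel_injective n i this]
    · obtain rfl : j = i + 1 := by omega
      refine absurd ?_ (topPt_notMem_map_relabel hn hi p).2
      rw [h, newPair_eq_topPt hn hj]
      exact Sym2.mem_mk_left _ _

theorem newPair_succ_mem_tail {n i j : ℕ} (hi : i ≤ n) (hji : j < i) {b : List ℕ}
    (h : newPair n j ∈ catState n (i :: b)) :
    j + 2 ≤ i ∧ newPair n (j + 1) ∈ catState n b := by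
  have hn : 1 ≤ n := by omega
  have hj : j ≤ n := by omega
  rcases h with h | ⟨p, hp, h⟩
  · exact absurd (newPair_inj hn hj hi h) (by omega)
  · rcases Nat.lt_or_ge (j + 1) i with hlt | hge
    · refine ⟨hlt, ?_⟩
      have := map_relabel_newPair_of_gt (n := n) (x := j) (y := i - 1) (by omega) (by omega)
      rw [Nat.sub_add_cancel (by omega), ← h] at this
      rwa [map_relabel_injective n i this]
    · obtain rfl : i = j + 1 := by omega
      refine absurd ?_ (topPt_notMem_map_relabel hn hi p).1
      rw [h, newPair_eq_topPt hn hj]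
      exact Sym2.mem_mk_right _ _

theorem cons_mem_Pmn {m n x : ℕ} {b : List ℕ} :
    x :: b ∈ Pmn (m + 1) n ↔ x ≤ n ∧ b ∈ Pmn m n := by
  simp [Pmn]
  tauto

/-- Every cup on the ceiling of a realizable state is the cup of the first entry of some
sequence realizing that state. -/
theorem exists_cons_of_newPair_mem {n j : ℕ} (hj : j ≤ n) :
    ∀ {m : ℕ} {b : List ℕ}, b ∈ Pmn (m + 1) n → newPair n j ∈ catState n b →
      ∃ e ∈ Pmn m n, catState n (j :: e) = catState n b := by
  intro m
  induction m generalizing j with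
  | zero =>
    rintro b hb h
    match b, hb.1 with
    | [i], _ =>
      have hi := (cons_mem_Pmn.1 hb).1
      refine ⟨[], ⟨rfl, by simp⟩, ?_⟩
      rcases lt_trichotomy i j with hij | rfl | hij
      · exact absurd (newPair_pred_mem_tail hj hij h).2 (newPair_notMem_catState_nil _ _)
      · rfl
      · exact absurd (newPair_succ_mem_tail hi hij h).2 (newPair_notMem_catState_nil _ _)
  | succ m ih =>
    rintro b hb h
    match b, hb.1 with
    | i :: b, _ =>
      obtain ⟨hi, hb⟩ := cons_mem_Pmn.1 hb
      rcases lt_trichotomy i j with hij | rfl | hij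
      · obtain ⟨h2, hmem⟩ := newPair_pred_mem_tail hj hij h
        obtain ⟨e, he, hs⟩ := ih (by omega) hb hmem
        refine ⟨(i + 1) :: e, cons_mem_Pmn.2 ⟨by omega, he⟩, ?_⟩
        have := catState_move (n := n) (x := i) (y := j - 1) (by omega) (by omega) e
        rw [Nat.sub_add_cancel (by omega)] at this
        rw [← this]
        exact catState_cons_congr i hs
      · exact ⟨b, hb, rfl⟩
      · obtain ⟨h2, hmem⟩ := newPair_succ_mem_tail hi hij h
        obtain ⟨e, he, hs⟩ := ih (by omega) hb hmem
        refine ⟨(i - 1) :: e, cons_mem_Pmn.2 ⟨by omega, he⟩, ?_⟩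
        have := catState_move (n := n) (x := j) (y := i - 1) (by omega) (by omega) e
        rw [Nat.sub_add_cancel (by omega)] at this
        rw [this]
        exact catState_cons_congr i hs

/-- The embedding of boundary points of `B(m-1,n)` into those of `B(m,n)` that adds an arc
`{y'₁, y'₂}` and shifts the ceiling by one step to the left. -/
def rightArcRelabel (n : ℕ) (p : Bpt) : Bpt :=
  if p = .right 0 then .ceil (n - 1) else relabel n n p

theorem rightArcRelabel_injective {n : ℕ} (hn : 1 ≤ n) :
    Function.Injective (rightArcRelabel n) := by
  rintro (a | a | a | a) (b | b | b | b) h <;> simp only [relabel, rightArcRelabel] at h <;>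
    split_ifs at h <;> simp_all <;> omega

theorem rightArcRelabel_ne_right {n : ℕ} (hn : 1 ≤ n) (p : Bpt) :
    rightArcRelabel n p ≠ .right 0 := by
  rcases p with a | a | a | a <;> simp only [relabel, rightArcRelabel] <;> grind

theorem relabel_comp_relabel_last {n i : ℕ} (hi : i < n) :
    relabel n i ∘ relabel n n = rightArcRelabel n ∘ relabel n (i + 1) := by
  funext p
  rcases p with a | a | a | a <;> simp only [rightArcRelabel, Function.comp_apply]
  all_goals grind [relabel_ceil, relabel_floor, relabel_left, relabel_right]

theorem map_relabel_newPair_last {n i : ℕ} (hi : i < n) :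
    Sym2.map (relabel n i) (newPair n n) = s(.right 0, .right 1) := by
  unfold newPair
  split_ifs <;> simp only [Sym2.map_mk, relabel] <;> grind

theorem map_rightArcRelabel_newPair {n i : ℕ} (hi : i < n) :
    Sym2.map (rightArcRelabel n) (newPair n (i + 1)) = newPair n i := by
  unfold newPair
  split_ifs <;> simp only [Sym2.map_mk, relabel, rightArcRelabel] <;> grind

theorem catState_cons_last_cons {n i : ℕ} (hi : i < n) (e : List ℕ) :
    catState n (i :: n :: e) = insert s(.right 0, .right 1)
      (Sym2.map (rightArcRelabel n) '' catState n ((i + 1) :: e)) := by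
  simp only [catState, Set.image_insert_eq, ← Set.image_comp, ← Sym2.map_comp,
    relabel_comp_relabel_last hi, map_relabel_newPair_last hi, map_rightArcRelabel_newPair hi]
  exact Set.insert_comm _ _ _

/-- Removing an arc `{y'₁, y'₂}` from a state reduces the number of rows by one. -/
theorem catState_cons_last_cons_eq_iff {n i k : ℕ} (hi : i < n) (hk : k < n) (e f : List ℕ) :
    catState n (i :: n :: e) = catState n (k :: n :: f) ↔
      catState n ((i + 1) :: e) = catState n ((k + 1) :: f) := by
  have hn : 1 ≤ n := by omega
  have key : ∀ S : Set (Sym2 Bpt),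
      s(Bpt.right 0, Bpt.right 1) ∉ Sym2.map (rightArcRelabel n) '' S := by
    rintro S ⟨p, -, hp⟩
    have : Bpt.right 0 ∈ Sym2.map (rightArcRelabel n) p := hp ▸ Sym2.mem_mk_left _ _
    obtain ⟨q, -, hq⟩ := Sym2.mem_map.1 this
    exact rightArcRelabel_ne_right hn q hq
  rw [catState_cons_last_cons hi, catState_cons_last_cons hk]
  exact ⟨insert_image_inj (Sym2.map.injective (rightArcRelabel_injective hn)) (key _) (key _),
    fun h => by rw [h]⟩

/-- In every fiber some sequence strictly dominates all the others, both in weight and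
lexicographically. -/
theorem exists_top {n : ℕ} (hn : 1 ≤ n) : ∀ {m : ℕ} {b : List ℕ}, b ∈ Pmn m n →
    ∃ c ∈ Pmn m n, catState n c = catState n b ∧ ∀ d ∈ Pmn m n, catState n d = catState n b →
      d = c ∨ (d.sum < c.sum ∧ d < c) := by
  intro m
  induction m with
  | zero =>
    intro b hb
    refine ⟨b, hb, rfl, fun d hd _ => Or.inl ?_⟩
    rw [List.length_eq_zero_iff.1 hb.1, List.length_eq_zero_iff.1 hd.1]
  | succ m ih =>
    intro b hb
    classical
    -- the largest position of a cup on the ceiling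
    obtain ⟨j, hj, hjmem, hjmax⟩ : ∃ j ≤ n, newPair n j ∈ catState n b ∧
        ∀ i ≤ n, newPair n i ∈ catState n b → i ≤ j := by
      obtain ⟨i₀, hi₀, hmem⟩ : ∃ i ≤ n, newPair n i ∈ catState n b := by
        match b, hb.1 with
        | i :: b, _ => exact ⟨i, (cons_mem_Pmn.1 hb).1, newPair_mem_catState_cons _ _ _⟩
      exact ⟨_, Nat.findGreatest_le n,
        Nat.findGreatest_spec (P := fun i => newPair n i ∈ catState n b) hi₀ hmem,
        fun i hi h => Nat.le_findGreatest hi h⟩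
    obtain ⟨e₀, he₀, hes₀⟩ := exists_cons_of_newPair_mem hj hb hjmem
    obtain ⟨e, he, hes, hetop⟩ := ih he₀
    have hsum : ∀ f ∈ Pmn m n, catState n (j :: f) = catState n b → f.sum ≤ e.sum := by
      intro f hf h
      rcases hetop f hf (catState_tail_eq hn hj (h.trans hes₀.symm)) with rfl | h
      · exact le_rfl
      · exact h.1.le
    have hmax : ∀ {i f}, i ≤ n → catState n (i :: f) = catState n b → i ≤ j :=
      fun {i f} hi h => hjmax i hi (h ▸ newPair_mem_catState_cons n i f)
    refine ⟨j :: e, cons_mem_Pmn.2 ⟨hj, he⟩, (catState_cons_congr j hes).trans hes₀, ?_⟩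
    rintro d hd hds
    match d, hd.1 with
    | i :: d, _ =>
    obtain ⟨hi, hd⟩ := cons_mem_Pmn.1 hd
    rcases (hmax hi hds).eq_or_lt with rfl | hij
    · rcases hetop d hd (catState_tail_eq hn hi (hds.trans hes₀.symm)) with rfl | ⟨h1, h2⟩
      · exact Or.inl rfl
      · exact Or.inr ⟨by simpa using h1, List.Lex.cons h2⟩
    refine Or.inr ⟨?_, List.Lex.rel hij⟩
    obtain ⟨h2, hjd⟩ := newPair_pred_mem_tail hj hij (hds.symm ▸ hjmem)
    obtain ⟨t, ht, hts, httop⟩ := ih hd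
    have hdt : d.sum ≤ t.sum := by
      rcases httop d hd rfl with rfl | h
      · exact le_rfl
      · exact h.1.le
    have hits : catState n (i :: t) = catState n b := (catState_cons_congr i hts).trans hds
    match m, t, ht.1 with
    | 0, [], _ => exact absurd (hts ▸ hjd) (newPair_notMem_catState_nil _ _)
    | m + 1, k :: t, _ =>
    obtain ⟨hk, ht⟩ := cons_mem_Pmn.1 ht
    have hjk : j - 1 ≤ k := by
      obtain ⟨g, hg, hgs⟩ := exists_cons_of_newPair_mem (by omega) hd hjd
      rcases httop _ (cons_mem_Pmn.2 ⟨by omega, hg⟩) hgs with h | ⟨-, h⟩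
      · exact (List.cons.inj h).1.le
      · rcases List.cons_lt_cons_iff.1 h with h | h <;> omega
    simp only [List.sum_cons] at hdt ⊢
    rcases hk.lt_or_eq with hkn | rfl
    · have hs := (catState_move (n := n) (x := i) (by omega) hkn t).symm.trans hits
      have := hmax (by omega) hs
      obtain rfl : j = k + 1 := by omega
      have := hsum _ (cons_mem_Pmn.2 ⟨by omega, ht⟩) hs
      simp only [List.sum_cons] at this
      omega
    · obtain ⟨h3, hjt⟩ := newPair_succ_mem_tail le_rfl (by omega) (hts.symm ▸ hjd)
      obtain ⟨m, rfl⟩ : ∃ m', m = m' + 1 := by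
        match m, t, ht.1 with
        | 0, [], _ => exact absurd hjt (newPair_notMem_catState_nil _ _)
        | m + 1, _, _ => exact ⟨m, rfl⟩
      obtain ⟨h, hh, hhs⟩ := exists_cons_of_newPair_mem (by omega) ht hjt
      obtain ⟨l, rfl⟩ : ∃ l, j = l + 1 := ⟨j - 1, by omega⟩
      obtain ⟨q, rfl⟩ : ∃ q, k = q + 1 := ⟨k - 1, by omega⟩
      have hswap : catState (q + 1) (i :: (q + 1) :: t) =
          catState (q + 1) ((l + 1) :: (q + 1) :: (i + 2) :: h) := by
        rw [← catState_cons_congr i (catState_cons_congr (q + 1) hhs)]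
        rw [show l + 1 - 1 + 1 = l + 1 by omega]
        rw [← catState_cons_congr i (catState_move (n := q + 1) (x := l) (y := q)
          (by omega) (by omega) h), catState_move (by omega) (by omega),
          catState_cons_congr (l + 1) (catState_move (n := q + 1) (x := i + 1) (y := q)
          (by omega) (by omega) h)]
      have hred := (catState_cons_last_cons_eq_iff (by omega) (by omega) _ _).1 hswap
      obtain ⟨c, hc, hcs, hctop⟩ := ih (b := (l + 2) :: (i + 2) :: h)
        (cons_mem_Pmn.2 ⟨by omega, cons_mem_Pmn.2 ⟨by omega, hh⟩⟩)
      match c, hc.1 with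
      | r :: w, _ =>
      obtain ⟨hr, hw⟩ := cons_mem_Pmn.1 hc
      have hlr : l + 2 ≤ r := by
        rcases hctop _ (cons_mem_Pmn.2 ⟨by omega, cons_mem_Pmn.2 ⟨by omega, hh⟩⟩) rfl
          with h | ⟨-, h⟩
        · exact (List.cons.inj h).1.le
        · rcases List.cons_lt_cons_iff.1 h with h | h <;> omega
      obtain ⟨r, rfl⟩ : ∃ r', r = r' + 1 := ⟨r - 1, by omega⟩
      have hrw : catState (q + 1) (r :: (q + 1) :: w) = catState (q + 1) b :=
        ((catState_cons_last_cons_eq_iff (by omega) (by omega) _ _).2 (hcs.trans hred.symm)).trans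
          hits
      have := hmax (by omega) hrw
      obtain rfl : r = l + 1 := by omega
      have hle := hsum _ (cons_mem_Pmn.2 ⟨le_rfl, hw⟩) hrw
      have hlt : ((i + 1) :: t).sum < ((l + 1 + 1) :: w).sum := by
        rcases hctop _ (cons_mem_Pmn.2 ⟨by omega, ht⟩) hred with h | h
        · have := (List.cons.inj h).1
          omega
        · exact h.1
      simp only [List.sum_cons] at hle hlt
      omega

/-- The reflection of the boundary of `B(m,n)` about its vertical axis. -/
def reflectPt (n : ℕ) : Bpt → Bpt
  | .ceil j => .ceil (if j < n then n - 1 - j else j)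
  | .floor j => .floor (if j < n then n - 1 - j else j)
  | .left i => .right i
  | .right i => .left i

theorem relabel_comp_reflectPt {n i : ℕ} (hn : 1 ≤ n) (hi : i ≤ n) :
    relabel n (n - i) ∘ reflectPt n = reflectPt n ∘ relabel n i := by
  funext p
  rcases p with a | a | a | a <;> simp only [relabel, reflectPt, Function.comp_apply]
  grind [reflectPt]

theorem map_reflectPt_newPair {n i : ℕ} (hn : 1 ≤ n) (hi : i ≤ n) :
    Sym2.map (reflectPt n) (newPair n i) = newPair n (n - i) := by
  unfold newPair
  split_ifs <;> simp only [Sym2.map_mk, reflectPt] <;> grind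

theorem catState_map_sub {n : ℕ} (hn : 1 ≤ n) (b : List ℕ) (hb : ∀ x ∈ b, x ≤ n) :
    catState n (b.map (n - ·)) = Sym2.map (reflectPt n) '' catState n b := by
  induction b with
  | nil =>
    ext p
    simp only [List.map_nil, catState, Set.mem_ofPred_eq, Set.mem_image]
    constructor
    · rintro ⟨j, hj, rfl⟩
      refine ⟨_, ⟨n - 1 - j, by omega, rfl⟩, ?_⟩
      simp only [Sym2.map_mk, reflectPt]
      grind
    · rintro ⟨_, ⟨j, hj, rfl⟩, rfl⟩
      refine ⟨n - 1 - j, by omega, ?_⟩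
      simp only [Sym2.map_mk, reflectPt]
      grind
  | cons i b ih =>
    simp only [List.mem_cons, forall_eq_or_imp] at hb
    simp only [List.map_cons, catState, ih hb.2, Set.image_insert_eq, ← Set.image_comp,
      ← Sym2.map_comp, relabel_comp_reflectPt hn hb.1, map_reflectPt_newPair hn hb.1]

theorem map_sub_mem_Pmn {m n : ℕ} {b : List ℕ} (hb : b ∈ Pmn m n) :
    b.map (n - ·) ∈ Pmn m n := by
  refine ⟨by simpa using hb.1, ?_⟩
  simp

theorem map_sub_map_sub {n : ℕ} {b : List ℕ} (hb : ∀ x ∈ b, x ≤ n) :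
    (b.map (n - ·)).map (n - ·) = b := by
  rw [List.map_map]
  refine (List.map_congr_left fun x hx => ?_).trans (List.map_id b)
  have := hb x hx
  simp only [Function.comp_apply, id]
  omega

theorem sum_map_sub_add_sum {n : ℕ} {b : List ℕ} (hb : ∀ x ∈ b, x ≤ n) :
    (b.map (n - ·)).sum + b.sum = b.length * n := by
  induction b with
  | nil => simp
  | cons i b ih =>
    simp only [List.mem_cons, forall_eq_or_imp] at hb
    have := ih hb.2
    simp only [List.map_cons, List.sum_cons, List.length_cons, add_mul, one_mul]
    omega

theorem map_sub_lt_map_sub {n : ℕ} {b c : List ℕ} (hc : ∀ x ∈ c, x ≤ n)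
    (hlen : b.length = c.length) (h : b < c) : c.map (n - ·) < b.map (n - ·) := by
  induction b generalizing c with
  | nil =>
    obtain rfl := List.length_eq_zero_iff.1 hlen.symm
    exact absurd h (lt_irrefl _)
  | cons i b ih =>
    match c with
    | k :: c =>
      simp only [List.mem_cons, forall_eq_or_imp] at hc
      simp only [List.map_cons, List.cons_lt_cons_iff] at h ⊢
      rcases h with h | ⟨rfl, h⟩
      · left; omega
      · exact Or.inr ⟨rfl, ih hc.2 (by simpa using hlen) h⟩

/-- In every fiber some sequence is strictly dominated by all the others, both in weight and
lexicographically. -/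
theorem exists_bottom {m n : ℕ} (hn : 1 ≤ n) {b : List ℕ} (hb : b ∈ Pmn m n) :
    ∃ c ∈ Pmn m n, catState n c = catState n b ∧ ∀ d ∈ Pmn m n, catState n d = catState n b →
      d = c ∨ (c.sum < d.sum ∧ c < d) := by
  obtain ⟨c, hc, hcs, htop⟩ := exists_top hn (map_sub_mem_Pmn hb)
  refine ⟨c.map (n - ·), map_sub_mem_Pmn hc, ?_, fun d hd hds => ?_⟩
  · rw [catState_map_sub hn c hc.2, hcs, ← catState_map_sub hn _ (map_sub_mem_Pmn hb).2,
      map_sub_map_sub hb.2]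
  · have hds' : catState n (d.map (n - ·)) = catState n (b.map (n - ·)) := by
      rw [catState_map_sub hn d hd.2, catState_map_sub hn b hb.2, hds]
    rcases htop _ (map_sub_mem_Pmn hd) hds' with h | ⟨h1, h2⟩
    · left
      rw [← h, map_sub_map_sub hd.2]
    · right
      have h3 := sum_map_sub_add_sum hd.2
      have h4 := sum_map_sub_add_sum hc.2
      rw [hd.1] at h3
      rw [hc.1] at h4
      refine ⟨by omega, ?_⟩
      have := map_sub_lt_map_sub hc.2 (by simp [hd.1, hc.1]) h2
      rwa [map_sub_map_sub hd.2] at this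

/-- Let `C = C(b₀)` for some `b₀ ∈ P(m,n)`, and let `b_M` and `b_m` be the maximal and
minimal elements of the finite nonempty fiber `𝔟(C)` with respect to the lexicographic
order.  Then `b_M` is the unique element of `𝔟(C)` of maximal weight and `b_m` is the
unique element of minimal weight: every `b ∈ 𝔟(C)` with `b ≠ b_M` has `|b| < |b_M|`,
and every `b ∈ 𝔟(C)` with `b ≠ b_m` has `|b| > |b_m|`. -/
theorem weight_extremes_are_lex_extremes (m n : ℕ) (hm : 1 ≤ m) (hn : 1 ≤ n)
    (b₀ : List ℕ) (hb₀ : b₀ ∈ Pmn m n)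
    (bM bm : List ℕ)
    (hbM : bM ∈ bSet m n (catState n b₀))
    (hbMmax : ∀ b ∈ bSet m n (catState n b₀), b = bM ∨ List.Lex (· < ·) b bM)
    (hbm : bm ∈ bSet m n (catState n b₀))
    (hbmmin : ∀ b ∈ bSet m n (catState n b₀), b = bm ∨ List.Lex (· < ·) bm b) :
    (∀ b ∈ bSet m n (catState n b₀), b ≠ bM → b.sum < bM.sum) ∧
    (∀ b ∈ bSet m n (catState n b₀), b ≠ bm → bm.sum < b.sum) := by
  constructor
  · obtain ⟨c, hc, hcs, htop⟩ := exists_top hn hb₀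
    obtain rfl : bM = c := by
      rcases htop bM hbM.1 hbM.2 with h | ⟨-, h⟩
      · exact h
      · exact (hbMmax c ⟨hc, hcs⟩).elim Eq.symm fun h' => absurd h (lt_asymm (α := List ℕ) h')
    exact fun b hb hne => ((htop b hb.1 hb.2).resolve_left hne).1
  · obtain ⟨c, hc, hcs, hbot⟩ := exists_bottom hn hb₀
    obtain rfl : bm = c := by
      rcases hbot bm hbm.1 hbm.2 with h | ⟨-, h⟩
      · exact h
      · exact (hbmmin c ⟨hc, hcs⟩).elim Eq.symm fun h' => absurd h (lt_asymm (α := List ℕ) h')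
    exact fun b hb hne => ((hbot b hb.1 hb.2).resolve_left hne).1
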